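/- Let A ∈ C^{m×n} and B ∈ C^{n×ℓ} with A^[†] and B^[†] existing, and set D = AB. Then rank([[D, A A^[*] D],[D B^[*] B, D D^[*] D]]) = rank(D) if and only if (AB)^[†] exists and (AB)^[†] = B^[†] A^[†]. -/

import Mathlib

open Matrix

/-- The weighted (MN-) adjoint `A^[*] = N⁻¹ Aᴴ M` of a matrix between
indefinite inner product spaces with weights `M` (output) and `N` (input). -/
noncomputable def wadj {m n : ℕ} (M : Matrix (Fin m) (Fin m) ℂ)
    (N : Matrix (Fin n) (Fin n) ℂ) (A : Matrix (Fin m) (Fin n) ℂ) :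
    Matrix (Fin n) (Fin m) ℂ := N⁻¹ * Aᴴ * M

/-- `X` is the weighted Moore-Penrose inverse of `A` w.r.t. weights `M`, `N`:
the four weighted Penrose equations. -/
def IsWMP {m n : ℕ} (M : Matrix (Fin m) (Fin m) ℂ)
    (N : Matrix (Fin n) (Fin n) ℂ) (A : Matrix (Fin m) (Fin n) ℂ)
    (X : Matrix (Fin n) (Fin m) ℂ) : Prop :=
  A * X * A = A ∧ X * A * X = X ∧
    wadj M M (A * X) = A * X ∧ wadj N N (X * A) = X * A


theorem wadj_mul' {m n l : ℕ} (M : Matrix (Fin m) (Fin m) ℂ) (N : Matrix (Fin n) (Fin n) ℂ)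
    (L : Matrix (Fin l) (Fin l) ℂ) (hNu : IsUnit N)
    (A : Matrix (Fin m) (Fin n) ℂ) (B : Matrix (Fin n) (Fin l) ℂ) :
    wadj M L (A * B) = wadj N L B * wadj M N A := by
  have h : IsUnit N.det := (Matrix.isUnit_iff_isUnit_det N).1 hNu
  simp only [wadj, Matrix.conjTranspose_mul, Matrix.mul_assoc]
  rw [Matrix.mul_nonsing_inv_cancel_left _ _ h]

theorem wadj_wadj' {m n : ℕ} (M : Matrix (Fin m) (Fin m) ℂ) (N : Matrix (Fin n) (Fin n) ℂ)
    (hM : M.IsHermitian) (hMu : IsUnit M) (hN : N.IsHermitian) (hNu : IsUnit N)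
    (A : Matrix (Fin m) (Fin n) ℂ) : wadj N M (wadj M N A) = A := by
  have h : IsUnit N.det := (Matrix.isUnit_iff_isUnit_det N).1 hNu
  have h' : IsUnit M.det := (Matrix.isUnit_iff_isUnit_det M).1 hMu
  simp only [wadj, Matrix.conjTranspose_mul, Matrix.conjTranspose_conjTranspose,
    Matrix.conjTranspose_nonsing_inv, hM.eq, hN.eq, Matrix.mul_assoc]
  rw [Matrix.nonsing_inv_mul_cancel_left _ _ h', Matrix.nonsing_inv_mul _ h, Matrix.mul_one]

theorem rank_factor {p q r : Type} [Fintype p] [Fintype q] [Fintype r] [DecidableEq q]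
    [DecidableEq p] [DecidableEq r]
    (F : Matrix p q ℂ) (K : Matrix q r ℂ) (h : F.rank ≤ (F * K).rank) :
    ∃ Z : Matrix r q ℂ, F * K * Z = F := by
  have hle : LinearMap.range (F * K).mulVecLin ≤ LinearMap.range F.mulVecLin := by
    rw [Matrix.mulVecLin_mul]; exact LinearMap.range_comp_le_range _ _
  have heq := Submodule.eq_of_le_of_finrank_le hle h
  have hc : ∀ j, ∃ z : r → ℂ, (F * K) *ᵥ z = F *ᵥ (Pi.single j 1) := by
    intro j
    have : F.mulVecLin (Pi.single j 1) ∈ LinearMap.range (F * K).mulVecLin := by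
      rw [heq]; exact ⟨_, rfl⟩
    exact this
  choose z hz using hc
  refine ⟨Matrix.of fun i j => z j i, ?_⟩
  ext i j
  have := congrFun (hz j) i
  rw [Matrix.mulVec_single_one] at this
  exact this

theorem rank_factor' {p q r : Type} [Fintype p] [Fintype q] [Fintype r] [DecidableEq q]
    [DecidableEq p] [DecidableEq r]
    (F : Matrix p q ℂ) (K : Matrix r p ℂ) (h : F.rank ≤ (K * F).rank) :
    ∃ Z : Matrix p r ℂ, Z * (K * F) = F := by
  obtain ⟨Z, hZ⟩ := rank_factor Fᵀ Kᵀ (by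
    rw [← Matrix.transpose_mul, Matrix.rank_transpose, Matrix.rank_transpose]; exact h)
  refine ⟨Zᵀ, ?_⟩
  have := congrArg Matrix.transpose hZ
  simpa [Matrix.transpose_mul] using this

theorem block_rank {m l : ℕ} (D E F G : Matrix (Fin m) (Fin l) ℂ) :
    (Matrix.fromBlocks D E F G).rank = D.rank ↔
    ∃ (Z : Matrix (Fin l) (Fin l) ℂ) (W : Matrix (Fin m) (Fin m) ℂ),
      D * Z = E ∧ W * D = F ∧ W * D * Z = G := by
  constructor
  · intro h
    set T := Matrix.fromBlocks D E F G with hT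
    let K1 : Matrix (Fin l ⊕ Fin l) (Fin l) ℂ := Matrix.fromRows 1 0
    let K2 : Matrix (Fin l ⊕ Fin l) (Fin l) ℂ := Matrix.fromRows 0 1
    let J1 : Matrix (Fin m) (Fin m ⊕ Fin m) ℂ := Matrix.fromCols 1 0
    let J2 : Matrix (Fin m) (Fin m ⊕ Fin m) ℂ := Matrix.fromCols 0 1
    have hK1 : T * K1 = Matrix.fromRows D F := by
      simp [hT, K1, Matrix.fromBlocks_mul_fromRows]
    have hK2 : T * K2 = Matrix.fromRows E G := by
      simp [hT, K2, Matrix.fromBlocks_mul_fromRows]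
    have e11 : J1 * (T * K1) = D := by rw [hK1]; simp [J1, Matrix.fromCols_mul_fromRows]
    have e12 : J1 * (T * K2) = E := by rw [hK2]; simp [J1, Matrix.fromCols_mul_fromRows]
    have e21 : J2 * (T * K1) = F := by rw [hK1]; simp [J2, Matrix.fromCols_mul_fromRows]
    have e22 : J2 * (T * K2) = G := by rw [hK2]; simp [J2, Matrix.fromCols_mul_fromRows]
    obtain ⟨Z, hZ⟩ := rank_factor T K1 (by
      rw [h]; conv_lhs => rw [← e11]
      exact Matrix.rank_mul_le_right _ _)
    obtain ⟨W, hW⟩ := rank_factor' T J1 (by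
      rw [h]; conv_lhs => rw [← e11, ← Matrix.mul_assoc]
      exact Matrix.rank_mul_le_left _ _)
    have a1 : D * (Z * K2) = E := by
      rw [← e12]; conv_rhs => rw [← hZ]
      rw [← e11]; simp only [Matrix.mul_assoc]
    have a2 : (J2 * W) * D = F := by
      rw [← e21]; conv_rhs => rw [← hW]
      rw [← e11]; simp only [Matrix.mul_assoc]
    refine ⟨Z * K2, J2 * W, a1, a2, ?_⟩
    rw [a2, ← e22]; conv_rhs => rw [← hZ]
    rw [← e21]; simp only [Matrix.mul_assoc]
  · rintro ⟨Z, W, rfl, rfl, rfl⟩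
    have e : Matrix.fromBlocks D (D * Z) (W * D) (W * D * Z) =
        Matrix.fromRows 1 W * (D * Matrix.fromCols 1 Z) := by
      rw [Matrix.mul_fromCols, Matrix.fromRows_mul_fromCols]
      simp [Matrix.mul_assoc]
    apply le_antisymm
    · rw [e]
      exact (Matrix.rank_mul_le_right _ _).trans (Matrix.rank_mul_le_left _ _)
    · have : D = (Matrix.fromCols 1 0 : Matrix (Fin m) (Fin m ⊕ Fin m) ℂ) *
          (Matrix.fromBlocks D (D * Z) (W * D) (W * D * Z) *
            (Matrix.fromRows 1 0 : Matrix (Fin l ⊕ Fin l) (Fin l) ℂ)) := by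
        simp [Matrix.fromBlocks_mul_fromRows, Matrix.fromCols_mul_fromRows]
      conv_lhs => rw [this]
      exact (Matrix.rank_mul_le_right _ _).trans (Matrix.rank_mul_le_left _ _)

theorem ra {a b c d : ℕ} {U : Matrix (Fin a) (Fin b) ℂ} {V : Matrix (Fin b) (Fin c) ℂ}
    {W : Matrix (Fin a) (Fin c) ℂ} (h : U * V = W) (R : Matrix (Fin c) (Fin d) ℂ) :
    U * (V * R) = W * R := by rw [← Matrix.mul_assoc, h]

theorem ra3 {a b c d e : ℕ} {U : Matrix (Fin a) (Fin b) ℂ} {V : Matrix (Fin b) (Fin c) ℂ}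
    {V' : Matrix (Fin c) (Fin d) ℂ}
    {W : Matrix (Fin a) (Fin d) ℂ} (h : U * (V * V') = W) (R : Matrix (Fin d) (Fin e) ℂ) :
    U * (V * (V' * R)) = W * R := by rw [← h]; simp only [Matrix.mul_assoc]

theorem stmt_10 {m n l : ℕ} (M : Matrix (Fin m) (Fin m) ℂ) (N : Matrix (Fin n) (Fin n) ℂ)
    (L : Matrix (Fin l) (Fin l) ℂ)
    (hM : M.IsHermitian) (hMu : IsUnit M) (hN : N.IsHermitian) (hNu : IsUnit N)
    (hL : L.IsHermitian) (hLu : IsUnit L)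
    (A : Matrix (Fin m) (Fin n) ℂ) (B : Matrix (Fin n) (Fin l) ℂ)
    (X : Matrix (Fin n) (Fin m) ℂ) (Y : Matrix (Fin l) (Fin n) ℂ)
    (hX : IsWMP M N A X) (hY : IsWMP N L B Y) :
    (Matrix.fromBlocks (A * B) (A * wadj M N A * (A * B))
        (A * B * (wadj N L B * B)) (A * B * wadj M L (A * B) * (A * B))).rank =
        (A * B).rank ↔
      IsWMP M L (A * B) (Y * X) := by
  obtain ⟨x1, x2, x3, x4⟩ := hX
  obtain ⟨y1, y2, y3, y4⟩ := hY
  have AA := wadj_wadj' M N hM hMu hN hNu A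
  have BB := wadj_wadj' N L hN hNu hL hLu B
  have p1 := x3
  have p2 := x4
  have q1 := y3
  have q2 := y4
  have x1s := congrArg (wadj M N) x1
  have x2s := congrArg (wadj N M) x2
  have y1s := congrArg (wadj N L) y1
  have y2s := congrArg (wadj L N) y2
  rw [wadj_mul' M M N hMu, x3] at x1s
  rw [wadj_mul' N N M hNu, x4] at x2s
  rw [wadj_mul' N N L hNu, y3] at y1s
  rw [wadj_mul' L L N hLu, y4] at y2s
  rw [wadj_mul' M N M hNu] at p1
  rw [wadj_mul' N M N hMu] at p2
  rw [wadj_mul' N L N hLu] at q1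
  rw [wadj_mul' L N L hNu] at q2
  have dd := wadj_mul' M N L hNu A B
  have ad3 : wadj M M (A * B * (Y * X)) = wadj N M X * (B * Y * wadj M N A) := by
    rw [show A * B * (Y * X) = A * (B * Y) * X by simp only [Matrix.mul_assoc],
      wadj_mul' M N M hNu, wadj_mul' M N N hNu, y3]
  have ad4 : wadj L L (Y * X * (A * B)) = wadj N L B * (X * A * wadj L N Y) := by
    rw [show Y * X * (A * B) = Y * (X * A) * B by simp only [Matrix.mul_assoc],
      wadj_mul' L N L hNu, wadj_mul' L N N hNu, x4]
  have adAA : wadj N N (wadj M N A * A) = wadj M N A * A := by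
    rw [wadj_mul' N M N hMu, AA]
  have adBB : wadj N N (B * wadj N L B) = B * wadj N L B := by
    rw [wadj_mul' N L N hLu, BB]
  have wm := fun U V => wadj_mul' N N N hNu U V
  rw [dd, block_rank]
  unfold IsWMP
  rw [ad3, ad4]
  generalize wadj M N A = As at *
  generalize wadj N L B = Bs at *
  generalize wadj N M X = Xs at *
  generalize wadj L N Y = Ys at *
  clear dd ad3 ad4 x3 AA BB
  generalize hP : X * A = P at *
  generalize hQ : B * Y = Q at *
  have AP : A * P = A := by rw [← hP, ← Matrix.mul_assoc, x1]
  have PX : P * X = X := x2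
  have QB : Q * B = B := y1
  have YQ : Y * Q = Y := by rw [← hQ, ← Matrix.mul_assoc, y2]
  have PAs : P * As = As := by rw [← p2, Matrix.mul_assoc, p1, x1s]
  have BsQ : Bs * Q = Bs := y1s
  have YBBs : Y * (B * Bs) = Bs := by
    rw [← Matrix.mul_assoc, ← q2, Matrix.mul_assoc, q1, y1s]
  have QYs : Q * Ys = Ys := by rw [← q1, Matrix.mul_assoc, q2, y2s]
  have XsP : Xs * P = Xs := x2s
  have XAAs : X * (A * As) = As := by rw [← Matrix.mul_assoc, hP, PAs]
  have BsBY : Bs * (B * Y) = Bs := by rw [hQ, BsQ]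
  have AsAX : As * (A * X) = As := x1s
  have XsAsA : Xs * (As * A) = A := by rw [← Matrix.mul_assoc, p1, Matrix.mul_assoc, hP, AP]
  have BBsYs : B * (Bs * Ys) = B := by rw [q2, ← Matrix.mul_assoc, hQ, QB]
  have aPQ : wadj N N (P * Q) = Q * P := by rw [wm, y3, x4]
  constructor
  · rintro ⟨Z, W, hZ, hW, hWZ⟩
    have d1 : A * B * (Y * X) * (A * B) = A * B := by
      obtain ⟨Z', hZ'⟩ := rank_factor (A * B) Z (by
        have : A * B = (Xs * X) * (A * B * Z) := by
          rw [hZ]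
          calc A * B = Xs * (As * A) * B := by rw [XsAsA]
            _ = Xs * (X * (A * As) * A) * B := by rw [XAAs]
            _ = _ := by simp only [Matrix.mul_assoc]
        conv_lhs => rw [this]
        exact Matrix.rank_mul_le_right _ _)
      obtain ⟨W', hW'⟩ := rank_factor' (A * B) W (by
        have : A * B = (W * (A * B)) * (Y * Ys) := by
          rw [hW]
          calc A * B = A * (B * (Bs * Ys)) := by rw [BBsYs]
            _ = A * (B * (Bs * (B * Y) * Ys)) := by rw [BsBY]
            _ = _ := by simp only [Matrix.mul_assoc]
        conv_lhs => rw [this]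
        exact Matrix.rank_mul_le_left _ _)
      have key : W * (A * B) * (Y * X) * (A * B * Z) = W * (A * B) * Z := by
        rw [hWZ, hW, hZ]
        calc A * B * (Bs * B) * (Y * X) * (A * As * (A * B))
            = A * B * (Bs * (B * Y)) * (X * (A * As)) * (A * B) := by
              simp only [Matrix.mul_assoc]
          _ = _ := by rw [BsBY, XAAs]; simp only [Matrix.mul_assoc]
      calc A * B * (Y * X) * (A * B)
          = (W' * (W * (A * B))) * (Y * X) * (A * B * Z * Z') := by rw [hZ', hW']
        _ = W' * (W * (A * B) * (Y * X) * (A * B * Z)) * Z' := by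
              simp only [Matrix.mul_assoc]
        _ = (W' * (W * (A * B))) * Z * Z' := by rw [key]; simp only [Matrix.mul_assoc]
        _ = A * B := by rw [hW', hZ']
    have pq : P * Q * (P * Q) = P * Q := by
      calc P * Q * (P * Q) = X * (A * B * (Y * X) * (A * B)) * Y := by
            rw [← hP, ← hQ]; simp only [Matrix.mul_assoc]
        _ = _ := by rw [d1, ← hP, ← hQ]; simp only [Matrix.mul_assoc]
    have qp : Q * P * (Q * P) = Q * P := by
      have := congrArg (wadj N N) pq
      rwa [wm, aPQ] at this
    refine ⟨d1, ?_, ?_, ?_⟩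
    · calc Y * X * (A * B) * (Y * X) = Y * (X * A) * (B * Y) * X := by
            simp only [Matrix.mul_assoc]
        _ = (Y * Q) * P * Q * (P * X) := by rw [hP, hQ, YQ, PX]
        _ = Y * (Q * P * (Q * P)) * X := by simp only [Matrix.mul_assoc]
        _ = (Y * Q) * (P * X) := by rw [qp]; simp only [Matrix.mul_assoc]
        _ = Y * X := by rw [YQ, PX]
    · have t1 : P * Q * (As * A) * Q = (As * A) * Q := by
        calc P * Q * (As * A) * Q = X * (A * B * (Y * X) * (A * As * (A * B))) * Y := by
              rw [← hP, ← hQ]; nth_rewrite 1 [← XAAs]; simp only [Matrix.mul_assoc]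
          _ = X * (A * As * (A * B)) * Y := by
              rw [← hZ, ← Matrix.mul_assoc (A * B * (Y * X)), d1]
          _ = (X * (A * As)) * A * (B * Y) := by simp only [Matrix.mul_assoc]
          _ = _ := by rw [XAAs, hQ]
      have t2 : Q * ((As * A) * (Q * P)) = Q * (As * A) := by
        have := congrArg (wadj N N) t1
        rwa [wm, wm, wm (As * A), adAA, y3, aPQ] at this
      have t3 : P * Q * (As * A) = As * A * Q * P := by
        calc P * Q * (As * A) = P * (Q * ((As * A) * (Q * P))) := by
              rw [t2]; simp only [Matrix.mul_assoc]
          _ = P * Q * (As * A) * Q * P := by simp only [Matrix.mul_assoc]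
          _ = _ := by rw [t1]
      calc Xs * (Q * As) = (Xs * P) * Q * (As * (A * X)) := by
            rw [XsP, AsAX]; simp only [Matrix.mul_assoc]
        _ = Xs * (P * Q * (As * A)) * X := by simp only [Matrix.mul_assoc]
        _ = (Xs * (As * A)) * Q * (P * X) := by rw [t3]; simp only [Matrix.mul_assoc]
        _ = _ := by rw [XsAsA, PX, ← hQ]; simp only [Matrix.mul_assoc]
    · have t1 : P * ((B * Bs) * (P * Q)) = P * (B * Bs) := by
        calc P * ((B * Bs) * (P * Q)) = X * (A * B * (Bs * B) * (Y * X) * (A * B)) * Y := by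
              rw [← hP, ← hQ]; nth_rewrite 1 [← BsBY]; simp only [Matrix.mul_assoc]
          _ = X * (W * (A * B * (Y * X) * (A * B))) * Y := by
              rw [← hW]; simp only [Matrix.mul_assoc]
          _ = (X * A) * B * (Bs * (B * Y)) := by
              rw [d1, hW]; simp only [Matrix.mul_assoc]
          _ = _ := by rw [BsBY, hP]; simp only [Matrix.mul_assoc]
      have t2 : Q * P * (B * Bs) * P = (B * Bs) * P := by
        have := congrArg (wadj N N) t1
        rwa [wm, wm (B * Bs), wm P (B * Bs), adBB, x4, aPQ] at this
      have t3 : Q * P * (B * Bs) = B * Bs * P * Q := by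
        calc Q * P * (B * Bs) = Q * (P * ((B * Bs) * (P * Q))) := by
              rw [t1]; simp only [Matrix.mul_assoc]
          _ = Q * P * (B * Bs) * P * Q := by simp only [Matrix.mul_assoc]
          _ = _ := by rw [t2]
      calc Bs * (P * Ys) = (Y * (B * Bs)) * P * (Q * Ys) := by
            rw [YBBs, QYs]; simp only [Matrix.mul_assoc]
        _ = Y * (B * Bs * P * Q) * Ys := by simp only [Matrix.mul_assoc]
        _ = (Y * Q) * P * (B * (Bs * Ys)) := by rw [← t3]; simp only [Matrix.mul_assoc]
        _ = _ := by rw [BBsYs, YQ, ← hP]; simp only [Matrix.mul_assoc]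
  · rintro ⟨d1, -, d3, d4⟩
    have c1 : As * A * Q * P = P * Q * (As * A) := by
      calc As * A * Q * P = As * (A * B * (Y * X)) * A := by
            rw [← hP, ← hQ]; simp only [Matrix.mul_assoc]
        _ = (As * Xs) * Q * (As * A) := by rw [← d3]; simp only [Matrix.mul_assoc]
        _ = _ := by rw [p2]
    have c2 : B * Bs * P * Q = Q * P * (B * Bs) := by
      calc B * Bs * P * Q = B * (Bs * (P * Ys)) * Bs := by
            rw [← q1]; simp only [Matrix.mul_assoc]
        _ = (B * Y) * (X * A) * (B * Bs) := by rw [d4]; simp only [Matrix.mul_assoc]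
        _ = _ := by rw [hQ, hP]
    have g1 : A * Q * (As * A) * B = A * (As * A) * B := by
      calc A * Q * (As * A) * B = (A * P) * Q * (As * A) * B := by rw [AP]
        _ = A * (As * A * Q * P) * B := by rw [c1]; simp only [Matrix.mul_assoc]
        _ = A * As * (A * B * (Y * X) * (A * B)) := by
            rw [← hP, ← hQ]; simp only [Matrix.mul_assoc]
        _ = _ := by rw [d1]; simp only [Matrix.mul_assoc]
    have g2 : A * (B * Bs) * P * B = A * (B * Bs) * B := by
      calc A * (B * Bs) * P * B = A * (B * Bs) * P * (Q * B) := by rw [QB]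
        _ = A * (B * Bs * P * Q) * B := by simp only [Matrix.mul_assoc]
        _ = (A * B * (Y * X) * (A * B)) * (Bs * B) := by
            rw [c2, ← hP, ← hQ]; simp only [Matrix.mul_assoc]
        _ = _ := by rw [d1]; simp only [Matrix.mul_assoc]
    have w1 : A * B * (Bs * B) * (Y * X) * (A * B) = A * B * (Bs * B) := by
      calc A * B * (Bs * B) * (Y * X) * (A * B)
          = A * B * (Bs * (B * Y)) * (X * A) * B := by simp only [Matrix.mul_assoc]
        _ = A * (B * Bs) * P * B := by rw [BsBY, hP]; simp only [Matrix.mul_assoc]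
        _ = _ := by rw [g2]; simp only [Matrix.mul_assoc]
    refine ⟨Y * (As * A) * B, A * B * (Bs * B) * (Y * X), ?_, w1, ?_⟩
    · calc A * B * (Y * (As * A) * B) = A * Q * (As * A) * B := by
            rw [← hQ]; simp only [Matrix.mul_assoc]
        _ = _ := by rw [g1]; simp only [Matrix.mul_assoc]
    · rw [w1]
      calc A * B * (Bs * B) * (Y * (As * A) * B)
          = A * B * (Bs * (B * Y)) * (As * A) * B := by simp only [Matrix.mul_assoc]
        _ = _ := by rw [BsBY]; simp only [Matrix.mul_assoc]
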